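/- arXiv:2407.03804 — 5 statements merged into one kernel-verified Lean document; each statement's English description precedes it below -/
import Mathlib

section
/- There exists a user index m* in {1,…,M} such that the price π* = τ_{m*} maximizes the revenue function over all nonnegative prices, i.e. U(π) ≤ U(τ_{m*}) for every π ≥ 0. (In particular, the base station's revenue-maximizing price equals the characteristic parameter τ_m = θ/f_m of some user.) -/
/-- For a finite, nonempty set of users with revenue coefficients `c m > 0` and price
thresholds `τ m > 0`, the base station revenue `U π = π * ∑_{m : π ≤ τ m} c m` attains its
maximum over all nonnegative prices at the characteristic parameter `τ m` of some user. -/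
theorem revenue_maximizer_is_some_threshold
    (M : ℕ) (hM : 1 ≤ M) (c τ : Fin M → ℝ)
    (hc : ∀ m, 0 < c m) (hτ : ∀ m, 0 < τ m)
    (U : ℝ → ℝ)
    (hU : ∀ π : ℝ, U π = π * ∑ m ∈ Finset.univ.filter (fun m => π ≤ τ m), c m) :
    ∃ mstar : Fin M, ∀ π : ℝ, 0 ≤ π → U π ≤ U (τ mstar) := by
  have : Nonempty (Fin M) := ⟨⟨0, hM⟩⟩
  obtain ⟨mstar, hmax⟩ := Finite.exists_max (fun m => U (τ m))
  refine ⟨mstar, fun π _ => ?_⟩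
  rcases (Finset.univ.filter (fun m => π ≤ τ m)).eq_empty_or_nonempty with hS | hS
  · rw [hU π, hS, Finset.sum_empty, mul_zero, hU]
    exact mul_nonneg (hτ mstar).le (Finset.sum_nonneg fun m _ => (hc m).le)
  · obtain ⟨k, hk, hmin⟩ := Finset.exists_min_image _ τ hS
    refine le_trans ?_ (hmax k)
    simp only [hU]
    refine mul_le_mul (Finset.mem_filter.mp hk).2 ?_
      (Finset.sum_nonneg fun m _ => (hc m).le) (hτ k).le
    refine Finset.sum_le_sum_of_subset_of_nonneg (fun m hm => ?_) fun m _ _ => (hc m).le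
    exact Finset.mem_filter.mpr ⟨Finset.mem_univ m, hmin m hm⟩
end

section
/- The user's optimal offloading proportion is a threshold rule in the price: if p ≤ θ·b, then δ minimizes the cost, i.e. C(δ) ≤ C(α) for all α ∈ [0,1]; and if p > θ·b, then 0 is the unique minimizer, i.e. C(0) < C(α) for all α ∈ (0,1]. (With p = r·π and b = r/f this says the user offloads the proportion δ exactly when the unit price π is at most its characteristic parameter θ/f, and otherwise computes entirely locally.) -/
/-- The user's optimal offloading proportion is a threshold rule in the price: if the
payment rate satisfies `p ≤ θ*b` then the threshold proportion `δ = b/(a+b)` minimizes the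
cost `C α = α*p + θ*max (α*a) ((1-α)*b)` over `[0,1]`; if `p > θ*b` then `0` is the unique
minimizer. -/
theorem optimal_offloading_threshold_rule
    (p θ a b : ℝ) (hp : 0 ≤ p) (hθ : 0 < θ) (ha : 0 < a) (hb : 0 < b)
    (δ : ℝ) (hδ : δ = b / (a + b))
    (C : ℝ → ℝ)
    (hC : ∀ α : ℝ, C α = α * p + θ * max (α * a) ((1 - α) * b)) :
    (p ≤ θ * b → ∀ α : ℝ, 0 ≤ α → α ≤ 1 → C δ ≤ C α) ∧
    (θ * b < p → ∀ α : ℝ, 0 < α → α ≤ 1 → C 0 < C α) := by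
  have left_le (α : ℝ) : α * p + θ * (α * a) ≤ C α := by
    rw [hC]
    gcongr
    exact le_max_left _ _
  have right_le (α : ℝ) : α * p + θ * ((1 - α) * b) ≤ C α := by
    rw [hC]
    gcongr
    exact le_max_right _ _
  refine ⟨fun h α _ _ => ?_, fun h α hα _ => ?_⟩
  · have balance : δ * a = (1 - δ) * b := by
      rw [hδ]
      field_simp
      ring
    have hCδ : C δ = δ * p + θ * (δ * a) := by rw [hC, ← balance, max_self]
    rcases le_total δ α with hle | hle
    · refine le_trans ?_ (left_le α)
      rw [hCδ]
      gcongr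
    · refine le_trans ?_ (right_le α)
      rw [hCδ, balance]
      linarith [mul_nonneg (sub_nonneg.2 hle) (sub_nonneg.2 h)]
  · have hC0 : C 0 = θ * b := by
      rw [hC, zero_mul, zero_mul, sub_zero, one_mul, max_eq_right hb.le, zero_add]
    linarith [right_le α, mul_pos hα (sub_pos.2 h)]
end

section
/- A Nash equilibrium of the selfish offloading subgame under incomplete information exists: there is a profile α* = (α*_1,…,α*_M) with α*_m ∈ [0,1] such that for every user m and every deviation α ∈ [0,1], C_m(α*_m) ≤ C_m(α). Moreover the equilibrium profile can be chosen so that each α*_m ∈ {0, δ_m}, where δ_m = b_m/(a_m+b_m). -/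
/-- If the payment rate is at least the delay saved, computing everything locally is optimal. -/
theorem offloading_cost_zero_le {p θ a b α : ℝ} (hθ : 0 < θ) (hb : 0 < b)
    (h : θ * b ≤ p) (hα : 0 ≤ α) :
    0 * p + θ * max (0 * a) ((1 - 0) * b) ≤ α * p + θ * max (α * a) ((1 - α) * b) := by
  have hmax : max (0 * a) ((1 - 0) * b) = b := by
    rw [zero_mul, sub_zero, one_mul, max_eq_right hb.le]
  have hloc := mul_le_mul_of_nonneg_left (le_max_right (α * a) ((1 - α) * b)) hθ.le
  rw [hmax]
  linarith [mul_le_mul_of_nonneg_left h hα]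

/-- If the payment rate is at most the delay saved, balancing the two delays is optimal. -/
theorem offloading_cost_balanced_le {p θ a b d α : ℝ} (hp : 0 ≤ p) (hθ : 0 < θ) (ha : 0 < a)
    (hd : d * a = (1 - d) * b) (h : p ≤ θ * b) :
    d * p + θ * max (d * a) ((1 - d) * b) ≤ α * p + θ * max (α * a) ((1 - α) * b) := by
  rw [← hd, max_self]
  rcases le_total α d with hαd | hdα
  · have hloc := mul_le_mul_of_nonneg_left (le_max_right (α * a) ((1 - α) * b)) hθ.le
    have hslope := mul_le_mul_of_nonneg_left h (sub_nonneg.2 hαd)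
    rw [hd]
    linarith
  · have hoff := mul_le_mul_of_nonneg_left (le_max_left (α * a) ((1 - α) * b)) hθ.le
    have hdelay := mul_le_mul_of_nonneg_left (mul_le_mul_of_nonneg_right hdα ha.le) hθ.le
    linarith [mul_le_mul_of_nonneg_right hdα hp]

/-- A Nash equilibrium of the selfish offloading subgame under incomplete information
exists: there is a profile `α* ∈ [0,1]^M` such that no user can lower its cost by a
unilateral deviation in `[0,1]`; moreover each `α*_m ∈ {0, δ_m}` with
`δ_m = b_m/(a_m+b_m)`. -/
theorem selfish_offloading_nash_equilibrium_exists
    (M : ℕ) (hM : 1 ≤ M)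
    (p : Fin M → ℝ) (hp : ∀ m, 0 ≤ p m)
    (θ : ℝ) (hθ : 0 < θ)
    (a b : Fin M → ℝ) (ha : ∀ m, 0 < a m) (hb : ∀ m, 0 < b m)
    (C : Fin M → ℝ → ℝ)
    (hC : ∀ m (α : ℝ), C m α = α * p m + θ * max (α * a m) ((1 - α) * b m)) :
    ∃ αstar : Fin M → ℝ,
      ∀ m : Fin M,
        αstar m ∈ Set.Icc (0 : ℝ) 1 ∧
        (αstar m = 0 ∨ αstar m = b m / (a m + b m)) ∧
        ∀ α ∈ Set.Icc (0 : ℝ) 1, C m (αstar m) ≤ C m α := by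
  refine ⟨fun m => if θ * b m ≤ p m then 0 else b m / (a m + b m), fun m => ?_⟩
  have hab : 0 < a m + b m := add_pos (ha m) (hb m)
  by_cases h : θ * b m ≤ p m
  · simp only [if_pos h, hC]
    exact ⟨⟨le_rfl, zero_le_one⟩, Or.inl trivial,
      fun α hα => offloading_cost_zero_le hθ (hb m) h hα.1⟩
  · simp only [if_neg h, hC]
    have hd : b m / (a m + b m) * a m = (1 - b m / (a m + b m)) * b m := by
      field_simp
      ring
    exact ⟨⟨(div_pos (hb m) hab).le, (div_le_one hab).2 (by linarith [ha m])⟩, Or.inr trivial,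
      fun α _ => offloading_cost_balanced_le (hp m) hθ (ha m) hd (not_le.1 h).le⟩
end

section
/- An optimal price vector for the base station exists in Stage I: there is a price vector π* with π*_n ≥ 0 for every program n such that U_BS(π) ≤ U_BS(π*) for every price vector π with all components nonnegative. -/
/-- Any price can be replaced by `0` or by one of finitely many thresholds, so that every threshold
above the old price is still above the new one, and the new price is at least the old one as soon
as there is such a threshold. -/
theorem exists_mem_insert_zero_between (s : Finset ℝ) (p : ℝ) :
    ∃ q ∈ insert 0 s, ∀ t ∈ s, p ≤ t → p ≤ q ∧ q ≤ t := by
  rcases (s.filter (p ≤ ·)).eq_empty_or_nonempty with h | h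
  · refine ⟨0, Finset.mem_insert_self _ _, fun t ht hpt => ?_⟩
    exact absurd hpt (Finset.filter_eq_empty_iff.mp h ht)
  · obtain ⟨q, hq, hmin⟩ := Finset.exists_min_image _ id h
    rw [Finset.mem_filter] at hq
    exact ⟨q, Finset.mem_insert_of_mem hq.1, fun t ht hpt =>
      ⟨hq.2, hmin t (Finset.mem_filter.mpr ⟨ht, hpt⟩)⟩⟩

/-- An optimal price vector for the base station exists in Stage I: there is a
componentwise nonnegative price vector `π*` maximizing the profit
`U_BS π = ∑_{m : π (ψ m) ≤ τ m} δ m * r m * π (ψ m)` over all componentwise nonnegative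
price vectors. -/
theorem optimal_price_vector_exists
    (N M : ℕ) (hM : 1 ≤ M)
    (ψ : Fin M → Fin N)
    (r : Fin M → ℝ) (hr : ∀ m, 0 < r m)
    (θ : ℝ) (hθ : 0 < θ)
    (a b : Fin M → ℝ) (ha : ∀ m, 0 < a m) (hb : ∀ m, 0 < b m)
    (τ δ : Fin M → ℝ)
    (hτ : ∀ m, τ m = θ * b m / r m)
    (hδ : ∀ m, δ m = b m / (a m + b m))
    (UBS : (Fin N → ℝ) → ℝ)
    (hUBS : ∀ π : Fin N → ℝ,
      UBS π = ∑ m ∈ Finset.univ.filter (fun m => π (ψ m) ≤ τ m), δ m * r m * π (ψ m)) :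
    ∃ πstar : Fin N → ℝ, (∀ n, 0 ≤ πstar n) ∧
      ∀ π : Fin N → ℝ, (∀ n, 0 ≤ π n) → UBS π ≤ UBS πstar := by
  have hτ0 : ∀ m, 0 ≤ τ m := fun m => by
    rw [hτ]
    exact div_nonneg (mul_nonneg hθ.le (hb m).le) (hr m).le
  have hw : ∀ m, 0 ≤ δ m * r m := fun m => by
    rw [hδ]
    exact mul_nonneg (div_nonneg (hb m).le (add_pos (ha m) (hb m)).le) (hr m).le
  let s : Finset ℝ := Finset.univ.image τ
  have hs : ∀ q ∈ insert 0 s, 0 ≤ q := by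
    intro q hq
    rcases Finset.mem_insert.mp hq with rfl | hq
    · exact le_rfl
    · obtain ⟨m, -, rfl⟩ := Finset.mem_image.mp hq
      exact hτ0 m
  obtain ⟨πstar, hmem, hmax⟩ :=
    (Fintype.piFinset fun _ : Fin N => insert 0 s).exists_max_image UBS
      ⟨0, Fintype.mem_piFinset.mpr fun _ => Finset.mem_insert_self _ _⟩
  refine ⟨πstar, fun n => hs _ (Fintype.mem_piFinset.mp hmem n), fun π _ => ?_⟩
  choose q hq hle using fun n => exists_mem_insert_zero_between s (π n)
  have hq' : ∀ m, π (ψ m) ≤ τ m → π (ψ m) ≤ q (ψ m) ∧ q (ψ m) ≤ τ m := fun m =>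
    hle (ψ m) (τ m) (Finset.mem_image_of_mem τ (Finset.mem_univ m))
  refine le_trans ?_ (hmax q (Fintype.mem_piFinset.mpr hq))
  rw [hUBS, hUBS, Finset.sum_filter, Finset.sum_filter]
  refine Finset.sum_le_sum fun m _ => ?_
  by_cases hm : π (ψ m) ≤ τ m
  · rw [if_pos hm, if_pos (hq' m hm).2]
    exact mul_le_mul_of_nonneg_left (hq' m hm).1 (hw m)
  · rw [if_neg hm]
    split_ifs
    · exact mul_nonneg (hw m) (hs _ (hq _))
    · exact le_rfl
end

section
/- A Stackelberg equilibrium of the two-stage game exists: there is a price vector π* with π*_n ≥ 0 for all programs n such that, defining the best-response profile α*_m = δ_m if π*_{ψ(m)} ≤ τ_m and α*_m = 0 otherwise, (i) U_BS(π) ≤ U_BS(π*) for every price vector π with all components nonnegative, and (ii) for every user m and every α ∈ [0,1], C_m(π*, α*_m) ≤ C_m(π*, α), i.e. neither the base station by changing prices (given users' best responses) nor any single user by changing its offloading proportion can improve its objective. -/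
/-- The revenue `∑ w m * p` over the agents whose threshold is at least the price `p` attains its
maximum over nonnegative prices. -/
theorem exists_revenue_maximizing_price {ι : Type*} (s : Finset ι) (w τ : ι → ℝ)
    (hw : ∀ m, 0 ≤ w m) :
    ∃ p : ℝ, 0 ≤ p ∧ ∀ q : ℝ, 0 ≤ q →
      ∑ m ∈ s.filter (fun m => q ≤ τ m), w m * q ≤
        ∑ m ∈ s.filter (fun m => p ≤ τ m), w m * p := by
  classical
  obtain ⟨p, hp, hmax⟩ := Finset.exists_max_image
    ((insert 0 (s.image τ)).filter (fun q : ℝ => 0 ≤ q))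
    (fun q => ∑ m ∈ s.filter (fun m => q ≤ τ m), w m * q) ⟨0, by simp⟩
  refine ⟨p, (Finset.mem_filter.1 hp).2, fun q hq => ?_⟩
  rcases (s.filter (fun m => q ≤ τ m)).eq_empty_or_nonempty with he | hne
  · have h0 := hmax 0 (by simp)
    simp only [mul_zero, Finset.sum_const_zero] at h0
    rw [he, Finset.sum_empty]
    exact h0
  · obtain ⟨k, hk, hmin⟩ := Finset.exists_min_image _ τ hne
    obtain ⟨hks, hqk⟩ := Finset.mem_filter.1 hk
    have hk0 : 0 ≤ τ k := hq.trans hqk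
    refine le_trans ?_ (hmax (τ k) (Finset.mem_filter.2
      ⟨Finset.mem_insert_of_mem (Finset.mem_image_of_mem τ hks), hk0⟩))
    calc ∑ m ∈ s.filter (fun m => q ≤ τ m), w m * q
        ≤ ∑ m ∈ s.filter (fun m => q ≤ τ m), w m * τ k :=
          Finset.sum_le_sum fun m _ => mul_le_mul_of_nonneg_left hqk (hw m)
      _ ≤ ∑ m ∈ s.filter (fun m => τ k ≤ τ m), w m * τ k :=
          Finset.sum_le_sum_of_subset_of_nonneg
            (fun m hm => Finset.mem_filter.2 ⟨(Finset.mem_filter.1 hm).1, hmin m hm⟩)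
            (fun m _ _ => mul_nonneg (hw m) hk0)

/-- The threshold rule minimizes a user's cost over offloading proportions in `[0, ∞)`. -/
theorem threshold_response_minimizes_cost {r θ a b p : ℝ} (hr : 0 < r) (hθ : 0 < θ) (ha : 0 < a)
    (hb : 0 < b) (hp : 0 ≤ p) {α : ℝ} (hα : 0 ≤ α) :
    (if p ≤ θ * b / r then b / (a + b) else 0) * r * p +
        θ * max ((if p ≤ θ * b / r then b / (a + b) else 0) * a)
          ((1 - (if p ≤ θ * b / r then b / (a + b) else 0)) * b) ≤
      α * r * p + θ * max (α * a) ((1 - α) * b) := by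
  have hleft := mul_le_mul_of_nonneg_left (le_max_left (α * a) ((1 - α) * b)) hθ.le
  have hright := mul_le_mul_of_nonneg_left (le_max_right (α * a) ((1 - α) * b)) hθ.le
  split_ifs with h
  · rw [le_div_iff₀ hr] at h
    have hbal : (1 - b / (a + b)) * b = b / (a + b) * a := by
      field_simp
      ring
    rw [hbal, max_self]
    generalize b / (a + b) = d at hbal ⊢
    rcases le_total d α with hd | hd
    · have h1 := mul_nonneg (sub_nonneg.2 hd) (mul_nonneg hr.le hp)
      have h2 := mul_nonneg (sub_nonneg.2 hd) (mul_nonneg hθ.le ha.le)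
      linarith
    · rw [← hbal]
      have h1 := mul_nonneg (sub_nonneg.2 hd) (sub_nonneg.2 h)
      linarith
  · rw [not_le, div_lt_iff₀ hr] at h
    have h1 := mul_nonneg hα (sub_nonneg.2 h.le)
    rw [zero_mul, zero_mul, zero_mul, sub_zero, one_mul, max_eq_right hb.le]
    linarith

/-- A Stackelberg equilibrium of the two-stage game exists: there is a componentwise
nonnegative price vector `π*` such that, with the users' threshold best responses
`α*_m = δ m` if `π* (ψ m) ≤ τ m` and `α*_m = 0` otherwise, (i) `π*` maximizes U_BS over
all componentwise nonnegative price vectors, and (ii) no user can lower its cost by a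
unilateral deviation in `[0,1]`. -/
theorem stackelberg_equilibrium_exists
    (N M : ℕ) (hM : 1 ≤ M)
    (ψ : Fin M → Fin N)
    (r : Fin M → ℝ) (hr : ∀ m, 0 < r m)
    (θ : ℝ) (hθ : 0 < θ)
    (a b : Fin M → ℝ) (ha : ∀ m, 0 < a m) (hb : ∀ m, 0 < b m)
    (τ δ : Fin M → ℝ)
    (hτ : ∀ m, τ m = θ * b m / r m)
    (hδ : ∀ m, δ m = b m / (a m + b m))
    (C : Fin M → (Fin N → ℝ) → ℝ → ℝ)
    (hCdef : ∀ m (π : Fin N → ℝ) (α : ℝ),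
      C m π α = α * r m * π (ψ m) + θ * max (α * a m) ((1 - α) * b m))
    (UBS : (Fin N → ℝ) → ℝ)
    (hUBS : ∀ π : Fin N → ℝ,
      UBS π = ∑ m ∈ Finset.univ.filter (fun m => π (ψ m) ≤ τ m), δ m * r m * π (ψ m)) :
    ∃ πstar : Fin N → ℝ, (∀ n, 0 ≤ πstar n) ∧
      ∃ αstar : Fin M → ℝ,
        (∀ m, αstar m = if πstar (ψ m) ≤ τ m then δ m else 0) ∧
        (∀ π : Fin N → ℝ, (∀ n, 0 ≤ π n) → UBS π ≤ UBS πstar) ∧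
        (∀ m : Fin M, ∀ α ∈ Set.Icc (0 : ℝ) 1, C m πstar (αstar m) ≤ C m πstar α) := by
  have hw : ∀ m, 0 ≤ δ m * r m := fun m => by
    rw [hδ]
    exact mul_nonneg (div_nonneg (hb m).le (add_pos (ha m) (hb m)).le) (hr m).le
  choose p hp0 hp using fun n : Fin N => exists_revenue_maximizing_price
    (Finset.univ.filter (fun m => ψ m = n)) (fun m => δ m * r m) τ hw
  have hsplit : ∀ π : Fin N → ℝ, UBS π =
      ∑ n, ∑ m ∈ (Finset.univ.filter (fun m => ψ m = n)).filter (fun m => π n ≤ τ m),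
        δ m * r m * π n := fun π => by
    rw [hUBS, ← Finset.sum_fiberwise _ ψ]
    refine Finset.sum_congr rfl fun n _ => Finset.sum_congr ?_ ?_
    · ext m
      simp only [Finset.mem_filter, Finset.mem_univ, true_and]
      constructor
      · rintro ⟨h, rfl⟩
        exact ⟨rfl, h⟩
      · rintro ⟨rfl, h⟩
        exact ⟨h, rfl⟩
    · intro m hm
      simp only [Finset.mem_filter, Finset.mem_univ, true_and] at hm
      rw [hm.1]
  refine ⟨p, hp0, fun m => if p (ψ m) ≤ τ m then δ m else 0, fun _ => rfl, fun π hπ => ?_,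
    fun m α hα => ?_⟩
  · rw [hsplit, hsplit]
    exact Finset.sum_le_sum fun n _ => hp n (π n) (hπ n)
  · simp only [hCdef, hτ, hδ]
    exact threshold_response_minimizes_cost (hr m) hθ (ha m) (hb m) (hp0 _) hα.1
end
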